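/- arXiv:2303.15438 — 7 statements merged into one kernel-verified Lean document; each statement's English description precedes it below -/
import Mathlib

section
/- Let m, d be positive integers, let A be a symmetric m×m real matrix and let B be a symmetric positive definite m×m real matrix. Define L(W) = -Tr(Wᵀ A W) + Tr((Wᵀ B W)²) for W ∈ ℝ^{m×d}. Then L has no suboptimal local minima: every W that is a local minimum point of L is a global minimizer of L over ℝ^{m×d}. -/
open Matrix

theorem poly_min (c1 c2 c3 c4 : ℝ)
    (h : ∀ᶠ t in nhds (0:ℝ), 0 ≤ c1 * t + c2 * t^2 + c3 * t^3 + c4 * t^4) :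
    c1 = 0 ∧ 0 ≤ c2 := by
  have h1 : c1 = 0 := by
    have hd : HasDerivAt (fun t : ℝ => c1 * t + c2 * t^2 + c3 * t^3 + c4 * t^4) c1 0 := by
      have := ((((hasDerivAt_id (0:ℝ)).const_mul c1).add
        ((hasDerivAt_pow 2 (0:ℝ)).const_mul c2)).add
        ((hasDerivAt_pow 3 (0:ℝ)).const_mul c3)).add ((hasDerivAt_pow 4 (0:ℝ)).const_mul c4)
      exact HasDerivAt.congr_deriv this (by simp)
    refine IsLocalMin.hasDerivAt_eq_zero ?_ hd
    filter_upwards [h] with t ht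
    simpa using ht
  refine ⟨h1, ?_⟩
  subst h1
  have ht : Filter.Tendsto (fun t : ℝ => c2 + c3 * t + c4 * t^2) (nhdsWithin 0 {0}ᶜ) (nhds c2) := by
    have : Continuous (fun t : ℝ => c2 + c3 * t + c4 * t^2) := by fun_prop
    have := (this.tendsto 0).mono_left (nhdsWithin_le_nhds (s := {0}ᶜ))
    simpa using this
  refine ge_of_tendsto ht ?_
  filter_upwards [h.filter_mono nhdsWithin_le_nhds, self_mem_nhdsWithin] with t h1 h2
  have h2 : 0 < t^2 := by
    have : t ≠ 0 := h2
    positivity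
  have : 0 ≤ t^2 * (c2 + c3 * t + c4 * t^2) := by nlinarith
  exact nonneg_of_mul_nonneg_right this h2

theorem real_diag {n : ℕ} (G : Matrix (Fin n) (Fin n) ℝ) (hG : G.IsHermitian) :
    ∃ U : Matrix (Fin n) (Fin n) ℝ, Uᵀ * U = 1 ∧ U * Uᵀ = 1 ∧
      G = U * diagonal hG.eigenvalues * Uᵀ := by
  refine ⟨hG.eigenvectorUnitary, ?_, ?_, ?_⟩
  · have := Unitary.coe_star_mul_self hG.eigenvectorUnitary
    simpa [star_eq_conjTranspose] using this
  · have := Unitary.coe_mul_star_self hG.eigenvectorUnitary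
    simpa [star_eq_conjTranspose] using this
  · have := hG.spectral_theorem
    rw [Unitary.conjStarAlgAut_apply] at this
    simpa [star_eq_conjTranspose, Function.comp_def] using this

theorem pinv {n : ℕ} (hn : 0 < n) (G : Matrix (Fin n) (Fin n) ℝ) (hG : G.PosSemidef) :
    ∃ (K : Matrix (Fin n) (Fin n) ℝ) (s : ℝ) (z : Fin n → ℝ), Kᵀ = K ∧ K * G * K = K ∧
      G * K * G = G ∧ (G * K).trace ≤ n ∧ s * (G * K).trace = s * n ∧
      (1 - s • K).PosSemidef ∧ 0 ≤ s ∧ z ⬝ᵥ z = 1 ∧ G *ᵥ z = s • z := by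
  obtain ⟨U, hU1, hU2, hGU⟩ := real_diag G hG.1
  have hl := hG.eigenvalues_nonneg
  set l := hG.1.eigenvalues with hldef
  have : Nonempty (Fin n) := ⟨⟨0, hn⟩⟩
  obtain ⟨i0, hi0⟩ := Finite.exists_min l
  have key : ∀ a b : Fin n → ℝ, (U * diagonal a * Uᵀ) * (U * diagonal b * Uᵀ)
      = U * diagonal (fun i => a i * b i) * Uᵀ := by
    intro a b
    rw [← diagonal_mul_diagonal]
    calc _ = U * diagonal a * (Uᵀ * U) * diagonal b * Uᵀ := by simp only [Matrix.mul_assoc]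
      _ = _ := by rw [hU1]; simp only [Matrix.mul_assoc, Matrix.one_mul]
  have ktr : ∀ a : Fin n → ℝ, (U * diagonal a * Uᵀ).trace = ∑ i, a i := by
    intro a
    rw [Matrix.trace_mul_comm, ← Matrix.mul_assoc, hU1, Matrix.one_mul, trace_diagonal]
  refine ⟨U * diagonal (fun i => (l i)⁻¹) * Uᵀ, l i0, U *ᵥ Pi.single i0 1, ?_, ?_, ?_, ?_, ?_, ?_,
    hl i0, ?_, ?_⟩
  · simp [Matrix.mul_assoc]
  · rw [hGU, key, key]
    congr; ext i; by_cases h : l i = 0 <;> simp [h]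
  · conv_lhs => rw [hGU]
    rw [key, key]
    conv_rhs => rw [hGU]
    congr; ext i; by_cases h : l i = 0 <;> simp [h]
  · rw [hGU, key, ktr]
    calc _ ≤ ∑ i : Fin n, (1:ℝ) := Finset.sum_le_sum fun i _ => by
          by_cases h : l i = 0 <;> simp [h]
      _ = n := by simp
  · rw [hGU, key, ktr]
    by_cases h : l i0 = 0
    · simp [h]
    · have : ∀ i, l i * (l i)⁻¹ = 1 := fun i => by
        have h0 := (hl i0).lt_of_ne' h
        exact mul_inv_cancel₀ (h0.trans_le (hi0 i)).ne'
      simp [this]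
  · have : (1 - l i0 • (U * diagonal (fun i => (l i)⁻¹) * Uᵀ))
        = U * diagonal (fun i => 1 - l i0 * (l i)⁻¹) * Uᵀ := by
      have e : diagonal (fun i => 1 - l i0 * (l i)⁻¹)
          = (1 : Matrix (Fin n) (Fin n) ℝ) - l i0 • diagonal (fun i => (l i)⁻¹) := by
        rw [← diagonal_one, ← diagonal_smul, diagonal_sub]; rfl
      rw [e, Matrix.mul_sub, Matrix.sub_mul, Matrix.mul_one, hU2]
      simp
    rw [this]
    have h : (diagonal (fun i => 1 - l i0 * (l i)⁻¹)).PosSemidef := by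
      refine PosSemidef.diagonal fun i => ?_
      have h0 := hl i
      have h1 := hi0 i
      show 0 ≤ 1 - l i0 * (l i)⁻¹
      have := mul_inv_le_one (a := l i)
      have := mul_le_mul_of_nonneg_right h1 (inv_nonneg.2 h0)
      linarith
    simpa using h.mul_mul_conjTranspose_same U
  · rw [Matrix.dotProduct_mulVec, ← Matrix.mulVec_transpose, Matrix.mulVec_mulVec, hU1]
    simp
  · conv_lhs => rw [hGU]
    rw [Matrix.mulVec_mulVec, Matrix.mul_assoc, hU1, Matrix.mul_one, ← Matrix.mulVec_mulVec]
    rw [← Matrix.mulVec_smul]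
    congr 1
    simp [← Pi.single_smul]

theorem proj_props {m n : ℕ} (V : Matrix (Fin m) (Fin n) ℝ) (K : Matrix (Fin n) (Fin n) ℝ)
    (hK : Kᵀ = K) (h1 : K * (Vᵀ * V) * K = K) (h2 : (Vᵀ * V) * K * (Vᵀ * V) = Vᵀ * V) :
    (V * K * Vᵀ)ᵀ = V * K * Vᵀ ∧ (V * K * Vᵀ) * (V * K * Vᵀ) = V * K * Vᵀ ∧
    (V * K * Vᵀ) * V = V ∧ (V * K * Vᵀ).trace = (Vᵀ * V * K).trace := by
  refine ⟨?_, ?_, ?_, ?_⟩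
  · simp [hK, Matrix.mul_assoc]
  · calc _ = V * (K * (Vᵀ * V) * K) * Vᵀ := by simp only [Matrix.mul_assoc]
      _ = _ := by rw [h1]
  · have : ((V * K * Vᵀ) * V - V)ᴴ * ((V * K * Vᵀ) * V - V) = 0 := by
      have e : ((V * K * Vᵀ) * V - V)ᴴ * ((V * K * Vᵀ) * V - V)
         = (Vᵀ * V) * (K * (Vᵀ * V) * K) * (Vᵀ * V) - (Vᵀ * V) * K * (Vᵀ * V)
           - (Vᵀ * V) * K * (Vᵀ * V) + Vᵀ * V := by
        simp only [conjTranspose_eq_transpose_of_trivial, transpose_sub, transpose_mul,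
          transpose_transpose, hK]
        simp only [Matrix.mul_sub, Matrix.sub_mul, Matrix.mul_assoc]
        abel
      rw [e, h1, h2]; simp
    exact sub_eq_zero.1 (conjTranspose_mul_self_eq_zero.1 this)
  · rw [Matrix.trace_mul_comm, ← Matrix.mul_assoc]

theorem tr_sq_nonneg {m n : ℕ} (M : Matrix (Fin m) (Fin n) ℝ) : 0 ≤ (Mᵀ * M).trace := by
  have := (posSemidef_conjTranspose_mul_self M).trace_nonneg
  simpa using this

theorem Pbound {m n : ℕ} (V : Matrix (Fin m) (Fin n) ℝ) (Z P : Matrix (Fin m) (Fin m) ℝ) (s : ℝ)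
    (hs : 0 ≤ s) (hZ : Z.PosSemidef) (hP : Pᵀ = P) (hPP : P * P = P) (hPV : P * V = V)
    (htr : P.trace ≤ n) :
    -(s^2 * n + 2 * s * Z.trace + (Z * Z).trace) ≤
      ((Vᵀ * V) * (Vᵀ * V)).trace - 2 * (s * (Vᵀ * V).trace + (Vᵀ * Z * V).trace) := by
  have hZt : Zᵀ = Z := by simpa using hZ.1.eq
  have hVP : Vᵀ * P = Vᵀ := by
    have := congrArg transpose hPV
    simpa [hP] using this
  have PP : ∀ {k : ℕ} (X : Matrix (Fin m) (Fin k) ℝ), P * (P * X) = P * X := fun X => by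
    rw [← Matrix.mul_assoc, hPP]
  have PVX : ∀ {k : ℕ} (X : Matrix (Fin n) (Fin k) ℝ), P * (V * X) = V * X := fun X => by
    rw [← Matrix.mul_assoc, hPV]
  have VPX : ∀ {k : ℕ} (X : Matrix (Fin m) (Fin k) ℝ), Vᵀ * (P * X) = Vᵀ * X := fun X => by
    rw [← Matrix.mul_assoc, hVP]
  -- bounds
  have b1 : (P * Z).trace ≤ Z.trace := by
    have := (hZ.conjTranspose_mul_mul_same (1 - P)).trace_nonneg
    have e : ((1 - P)ᴴ * Z * (1 - P)).trace = Z.trace - (P * Z).trace := by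
      rw [Matrix.trace_mul_comm, ← Matrix.mul_assoc]
      have : (1 - P) * (1 - P)ᴴ = 1 - P := by
        simp [hP, Matrix.mul_sub, Matrix.sub_mul, hPP]
      rw [this, Matrix.sub_mul, trace_sub, Matrix.one_mul]
    linarith
  have c1 : (Z * (P * (Z * P))).trace = (P * (Z * (P * Z))).trace := by
    rw [← Matrix.mul_assoc Z P, Matrix.trace_mul_comm]; simp only [Matrix.mul_assoc]
    rw [Matrix.trace_mul_comm]; simp only [Matrix.mul_assoc]
  have c3 : (P * (Z * (P * (Z * P)))).trace = (P * (Z * (P * Z))).trace := by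
    rw [Matrix.trace_mul_comm]; simp only [Matrix.mul_assoc, hPP]; exact c1
  have b2 : (P * (Z * (P * Z))).trace ≤ (Z * Z).trace := by
    have := tr_sq_nonneg (Z - P * Z * P)
    have e : ((Z - P * Z * P)ᵀ * (Z - P * Z * P)).trace = (Z * Z).trace - (P * (Z * (P * Z))).trace := by
      simp only [transpose_sub, transpose_mul, hP, hZt, Matrix.mul_sub, Matrix.sub_mul, trace_sub,
        Matrix.mul_assoc, PP, c1, c3]
      ring
    linarith
  have main := tr_sq_nonneg (V * Vᵀ - s • P - P * Z * P)
  have d1 : (V * (Vᵀ * (V * Vᵀ))).trace = (Vᵀ * (V * (Vᵀ * V))).trace := by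
    rw [Matrix.trace_mul_comm]; simp only [Matrix.mul_assoc]
  have d2 : (V * Vᵀ).trace = (Vᵀ * V).trace := Matrix.trace_mul_comm _ _
  have d3 : (V * (Vᵀ * (Z * P))).trace = (Vᵀ * (Z * V)).trace := by
    rw [Matrix.trace_mul_comm]; simp only [Matrix.mul_assoc, hPV]
  have d4 : (P * (Z * (V * Vᵀ))).trace = (Vᵀ * (Z * V)).trace := by
    rw [Matrix.trace_mul_comm]; simp only [Matrix.mul_assoc, hVP]
    rw [← Matrix.mul_assoc, Matrix.trace_mul_comm]
  have d5 : (P * (Z * P)).trace = (P * Z).trace := by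
    rw [Matrix.trace_mul_comm]; simp only [Matrix.mul_assoc, hPP]
    rw [Matrix.trace_mul_comm]
  simp only [transpose_sub, transpose_mul, transpose_smul, transpose_transpose, hP, hZt,
    Matrix.mul_sub, Matrix.sub_mul, trace_sub, Matrix.mul_assoc, PP, PVX, VPX, hPP, hVP,
    Matrix.mul_smul, Matrix.smul_mul, trace_smul, smul_eq_mul, d1, d2, d3, d4, d5, c3] at main
  simp only [Matrix.mul_assoc]
  nlinarith [mul_le_mul_of_nonneg_left htr (sq_nonneg s), mul_le_mul_of_nonneg_left b1 hs]

theorem local_conds {m d : ℕ} (Y : Matrix (Fin m) (Fin m) ℝ) (hY : Yᵀ = Y)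
    (L : Matrix (Fin m) (Fin d) ℝ → ℝ)
    (hL : ∀ W, L W = -2 * (Wᵀ * Y * W).trace + ((Wᵀ * W) * (Wᵀ * W)).trace)
    (W : Matrix (Fin m) (Fin d) ℝ) (hmin : IsLocalMin L W) (H : Matrix (Fin m) (Fin d) ℝ) :
    (Hᵀ * (Y * W - W * (Wᵀ * W))).trace = 0 ∧
    (Hᵀ * W = 0 → 0 ≤ -(Hᵀ * Y * H).trace + (Wᵀ * W * (Hᵀ * H)).trace) := by
  have hc : Filter.Tendsto (fun t : ℝ => W + t • H) (nhds 0) (nhds W) := by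
    have : Continuous (fun t : ℝ => W + t • H) := by fun_prop
    simpa using this.tendsto 0
  have hev := hc.eventually hmin
  set T := Hᵀ * W with hT
  have hTt : Wᵀ * H = Tᵀ := by simp [hT]
  have hexp : ∀ t : ℝ, L (W + t • H) - L W =
      (-4 * (Hᵀ * (Y * W - W * (Wᵀ * W))).trace) * t
      + (-2 * (Hᵀ * Y * H).trace + 2 * (Wᵀ * W * (Hᵀ * H)).trace
          + ((T + Tᵀ) * (T + Tᵀ)).trace) * t^2
      + (2 * ((T + Tᵀ) * (Hᵀ * H)).trace) * t^3 + ((Hᵀ * H) * (Hᵀ * H)).trace * t^4 := by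
    intro t
    have e1 : (W + t • H)ᵀ * (W + t • H) = Wᵀ * W + t • (T + Tᵀ) + t^2 • (Hᵀ * H) := by
      simp only [transpose_add, transpose_smul, Matrix.mul_add, Matrix.add_mul, Matrix.smul_mul,
        Matrix.mul_smul, hTt, ← hT, smul_add, smul_smul, pow_two]
      abel
    have e2 : (Wᵀ * Y * H).trace = (Hᵀ * Y * W).trace := by
      rw [← trace_transpose]; simp [hY, Matrix.mul_assoc]
    have e3 : ((W + t • H)ᵀ * Y * (W + t • H)).trace
        = (Wᵀ * Y * W).trace + 2 * t * (Hᵀ * Y * W).trace + t^2 * (Hᵀ * Y * H).trace := by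
      simp only [transpose_add, transpose_smul, Matrix.mul_add, Matrix.add_mul, Matrix.smul_mul,
        Matrix.mul_smul, trace_add, trace_smul, smul_eq_mul, e2]
      ring
    have e4 : (Hᵀ * (Y * W - W * (Wᵀ * W))).trace
        = (Hᵀ * Y * W).trace - (T * (Wᵀ * W)).trace := by
      simp only [hT, Matrix.mul_sub, trace_sub, Matrix.mul_assoc]
    have e5 : (Tᵀ * (Wᵀ * W)).trace = (T * (Wᵀ * W)).trace := by
      rw [← trace_transpose, Matrix.trace_mul_comm T]; simp [Matrix.mul_assoc]
    rw [hL, hL, e1, e3, e4]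
    generalize hG : Wᵀ * W = G at *
    generalize hS : Hᵀ * H = S at *
    have f1 : (G * T).trace = (T * G).trace := Matrix.trace_mul_comm _ _
    have f2 : (G * Tᵀ).trace = (T * G).trace := by rw [Matrix.trace_mul_comm, e5]
    have f3 : (S * T).trace = (T * S).trace := Matrix.trace_mul_comm _ _
    have f4 : (S * Tᵀ).trace = (Tᵀ * S).trace := Matrix.trace_mul_comm _ _
    have f5 : (S * G).trace = (G * S).trace := Matrix.trace_mul_comm _ _
    simp only [Matrix.mul_add, Matrix.add_mul, Matrix.smul_mul,
        Matrix.mul_smul, trace_add, trace_smul, smul_eq_mul, smul_add, f1, f2, f3, f4, f5, e5]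
    ring
  have := poly_min _ _ _ _ (by
    filter_upwards [hev] with t ht
    rw [← hexp t]; linarith)
  refine ⟨by linarith [this.1], fun h => ?_⟩
  have h2 := this.2
  rw [h] at h2
  simp at h2
  linarith

theorem core {m d : ℕ} (hd : 0 < d) (Y : Matrix (Fin m) (Fin m) ℝ) (hY : Yᵀ = Y)
    (L : Matrix (Fin m) (Fin d) ℝ → ℝ)
    (hL : ∀ W, L W = -2 * (Wᵀ * Y * W).trace + ((Wᵀ * W) * (Wᵀ * W)).trace)
    (W : Matrix (Fin m) (Fin d) ℝ) (hmin : IsLocalMin L W) (V : Matrix (Fin m) (Fin d) ℝ) :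
    L W ≤ L V := by
  have hcond := local_conds Y hY L hL W hmin
  have hYW : Y * W = W * (Wᵀ * W) := by
    have := (hcond (Y * W - W * (Wᵀ * W))).1
    rw [← conjTranspose_eq_transpose_of_trivial, trace_conjTranspose_mul_self_eq_zero_iff] at this
    exact sub_eq_zero.1 this
  have hps : ∀ V : Matrix (Fin m) (Fin d) ℝ, (Vᵀ * V).PosSemidef := fun V => by
    simpa using posSemidef_conjTranspose_mul_self V
  obtain ⟨K, s, z, hK, hK1, hK2, -, hst, hpsd, hs, hz, hGz⟩ := pinv hd _ (hps W)
  obtain ⟨KV, -, -, hKV, hKV1, hKV2, htrV, -⟩ := pinv hd _ (hps V)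
  obtain ⟨p1, p2, p3, p4⟩ := proj_props V KV hKV hKV1 hKV2
  obtain ⟨q1, q2, q3, q4⟩ := proj_props W K hK hK1 hK2
  rw [← p4] at htrV
  rw [← q4] at hst
  have hZ : (W * (1 - s • K) * Wᵀ).PosSemidef := by
    simpa using hpsd.mul_mul_conjTranspose_same W
  have hZe : W * (1 - s • K) * Wᵀ = W * Wᵀ - s • (W * K * Wᵀ) := by
    simp [Matrix.mul_sub, Matrix.sub_mul]
  rw [hZe] at hZ
  have hYQ : Y * (W * K * Wᵀ) = W * Wᵀ := by
    rw [← Matrix.mul_assoc, ← Matrix.mul_assoc, hYW]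
    have : Wᵀ * (W * K * Wᵀ) = Wᵀ := by
      have := congrArg transpose q3
      rwa [transpose_mul, q1] at this
    calc W * (Wᵀ * W) * K * Wᵀ = W * (Wᵀ * (W * K * Wᵀ)) := by simp only [Matrix.mul_assoc]
      _ = _ := by rw [this]
  set Q := W * K * Wᵀ with hQ
  have hQY : Q * Y = W * Wᵀ := by
    have := congrArg transpose hYQ
    simpa [q1, hY] using this
  have hQW : Q * (W * Wᵀ) = W * Wᵀ := by rw [← Matrix.mul_assoc, q3]
  have hWQ : (W * Wᵀ) * Q = W * Wᵀ := by
    have := congrArg transpose hQW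
    simpa [q1] using this
  have hbound := Pbound V _ _ s hs hZ p1 p2 p3 htrV
  -- the complement
  have hM : (s • (1 - Q) - (Y - W * Wᵀ)).PosSemidef := by
    refine PosSemidef.of_dotProduct_mulVec_nonneg ?_ fun x => ?_
    · simp [IsHermitian, q1, hY]
    have e : s • (1 - Q) - (Y - W * Wᵀ) = (1 - Q)ᵀ * (s • 1 - Y) * (1 - Q) := by
      simp only [transpose_sub, transpose_one, q1, Matrix.mul_sub, Matrix.sub_mul, Matrix.one_mul,
        Matrix.mul_one, Matrix.mul_smul, Matrix.smul_mul, q2, hYQ, hQY, hWQ, hQW, smul_sub]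
      abel
    have hc := (hcond (vecMulVec ((1 - Q) *ᵥ x) z)).2 (by
      rw [transpose_vecMulVec, vecMulVec_mul, ← mulVec_transpose, mulVec_mulVec, Matrix.mul_sub]
      have := congrArg transpose q3
      rw [transpose_mul, q1] at this
      simp [this])
    rw [e]
    set u := (1 - Q) *ᵥ x with hu
    have g1 : star x ⬝ᵥ ((1 - Q)ᵀ * (s • 1 - Y) * (1 - Q)) *ᵥ x = s * (u ⬝ᵥ u) - u ⬝ᵥ (Y *ᵥ u) := by
      rw [← mulVec_mulVec, ← hu, ← mulVec_mulVec, dotProduct_mulVec, vecMul_transpose]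
      simp [← hu, Matrix.sub_mulVec, smul_mulVec]
    rw [g1]
    have g2 : ((vecMulVec u z)ᵀ * Y * vecMulVec u z).trace = u ⬝ᵥ (Y *ᵥ u) := by
      rw [Matrix.mul_assoc, mul_vecMulVec, transpose_vecMulVec, vecMulVec_mul_vecMulVec,
        trace_vecMulVec]
      simp [hz]
    have g3 : (Wᵀ * W * ((vecMulVec u z)ᵀ * vecMulVec u z)).trace = s * (u ⬝ᵥ u) := by
      rw [transpose_vecMulVec, vecMulVec_mul_vecMulVec, mul_vecMulVec, hGz,
        trace_vecMulVec]
      simp [hz, mul_comm]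
    rw [g2, g3] at hc
    linarith
  have hMV := (hM.conjTranspose_mul_mul_same V).trace_nonneg
  have t1 : (W * Wᵀ).trace = (Wᵀ * W).trace := Matrix.trace_mul_comm _ _
  have t2 : (W * Wᵀ * (W * Wᵀ)).trace = (Wᵀ * W * (Wᵀ * W)).trace := by
    rw [Matrix.mul_assoc, Matrix.trace_mul_comm]; simp only [Matrix.mul_assoc]
  have t3 : (Wᵀ * Y * W).trace = (Wᵀ * W * (Wᵀ * W)).trace := by
    rw [Matrix.mul_assoc, hYW]; simp only [Matrix.mul_assoc]
  rw [hL, hL, t3]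
  simp only [conjTranspose_eq_transpose_of_trivial, Matrix.mul_sub, Matrix.sub_mul, smul_sub,
    trace_sub, trace_smul, Matrix.mul_smul, Matrix.smul_mul, smul_eq_mul, Matrix.mul_one,
    q2, hWQ, hQW, t1, t2] at hMV hbound
  nlinarith [hMV, hbound, congrArg (fun x => s * x) hst]

theorem no_suboptimal_local_minima_quartic
    (m d : ℕ) (hm : 0 < m) (hd : 0 < d)
    (A B : Matrix (Fin m) (Fin m) ℝ) (hA : A.IsSymm) (hB : B.PosDef)
    (L : Matrix (Fin m) (Fin d) ℝ → ℝ)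
    (hL : ∀ W, L W = -(Wᵀ * A * W).trace + ((Wᵀ * B * W) * (Wᵀ * B * W)).trace)
    (W₀ : Matrix (Fin m) (Fin d) ℝ) (hmin : IsLocalMin L W₀) :
    ∀ W : Matrix (Fin m) (Fin d) ℝ, L W₀ ≤ L W := by
  obtain ⟨U, hU1, hU2, hBU⟩ := real_diag B hB.1
  have hpos := hB.eigenvalues_pos
  set l := hB.1.eigenvalues
  have hs : ∀ i, √(l i) ≠ 0 := fun i => (Real.sqrt_pos.2 (hpos i)).ne'
  -- `B = Rᵀ R` with `S = R⁻¹`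
  obtain ⟨R, S, hRS, hSR, hSB⟩ : ∃ R S : Matrix (Fin m) (Fin m) ℝ, R * S = 1 ∧ S * R = 1 ∧
      Sᵀ * B * S = 1 := by
    have k : ∀ X : Matrix (Fin m) (Fin m) ℝ, Uᵀ * (U * X) = X := fun X => by
      rw [← Matrix.mul_assoc, hU1, Matrix.one_mul]
    have hRS : (diagonal (fun i => √(l i)) * Uᵀ) * (U * diagonal (fun i => (√(l i))⁻¹)) = 1 := by
      rw [Matrix.mul_assoc, k, diagonal_mul_diagonal, ← diagonal_one]
      congr; ext i; exact mul_inv_cancel₀ (hs i)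
    refine ⟨_, _, hRS, mul_eq_one_comm.1 hRS, ?_⟩
    rw [hBU]
    simp only [transpose_mul, diagonal_transpose, Matrix.mul_assoc, k, hU1, Matrix.mul_one,
      diagonal_mul_diagonal]
    rw [← diagonal_one]
    congr; ext i
    have := Real.mul_self_sqrt (hpos i).le
    have := hs i
    field_simp
    nlinarith
  have hS : ∀ W : Matrix (Fin m) (Fin d) ℝ, S * (R * W) = W := fun W => by
    rw [← Matrix.mul_assoc, hSR, Matrix.one_mul]
  have hA' : Aᵀ = A := hA
  have hm' : IsLocalMin (fun V => L (S * V)) (R * W₀) := by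
    have hc : Filter.Tendsto (fun V : Matrix (Fin m) (Fin d) ℝ => S * V) (nhds (R * W₀))
        (nhds W₀) := by
      have : Continuous (fun V : Matrix (Fin m) (Fin d) ℝ => S * V) := by fun_prop
      simpa [hS] using this.tendsto (R * W₀)
    filter_upwards [hc.eventually hmin] with V hV
    simpa only [hS] using hV
  intro W
  have := core hd ((1/2 : ℝ) • (Sᵀ * A * S)) (by simp [hA', Matrix.mul_assoc])
    (fun V => L (S * V)) (fun V => by
      have e : (S * V)ᵀ * B * (S * V) = Vᵀ * V := by
        calc _ = Vᵀ * (Sᵀ * B * S) * V := by simp only [transpose_mul, Matrix.mul_assoc]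
          _ = _ := by rw [hSB, Matrix.mul_one]
      simp only [hL, e]
      simp only [transpose_mul, Matrix.mul_assoc, Matrix.mul_smul, Matrix.smul_mul,
        trace_smul, smul_eq_mul]
      ring) (R * W₀) hm' (R * W)
  simpa only [hS] using this
end

section
/- Let C be a symmetric m×m real matrix and define L(Z) = -Tr(Zᵀ C Z) + Tr((Zᵀ Z)²) for Z ∈ ℝ^{m×d}. Then every local minimum point of L is a global minimizer of L over ℝ^{m×d}. -/
open Matrix

lemma aux_dot_nonneg {n : ℕ} (x : Fin n → ℝ) : 0 ≤ x ⬝ᵥ x :=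
  Finset.sum_nonneg fun i _ => mul_self_nonneg (x i)

lemma aux_poly (a b c e : ℝ)
    (h : ∀ᶠ t in nhds (0:ℝ), 0 ≤ t * a + t^2 * b + t^3 * c + t^4 * e) : a = 0 ∧ 0 ≤ b := by
  have lim1 : Filter.Tendsto (fun t : ℝ => a + t * b + t^2 * c + t^3 * e) (nhds 0) (nhds a) := by
    have : Continuous (fun t : ℝ => a + t * b + t^2 * c + t^3 * e) := by fun_prop
    simpa using this.tendsto 0
  have ha : a = 0 := by
    apply le_antisymm
    · refine le_of_tendsto (lim1.mono_left (nhdsWithin_le_nhds (s := Set.Iio 0))) ?_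
      filter_upwards [h.filter_mono nhdsWithin_le_nhds, self_mem_nhdsWithin] with t ht hlt
      have hlt : t < 0 := hlt
      by_contra hc
      push Not at hc
      nlinarith [mul_neg_of_neg_of_pos hlt hc]
    · refine ge_of_tendsto (lim1.mono_left (nhdsWithin_le_nhds (s := Set.Ioi 0))) ?_
      filter_upwards [h.filter_mono nhdsWithin_le_nhds, self_mem_nhdsWithin] with t ht hlt
      have hlt : 0 < t := hlt
      by_contra hc
      push Not at hc
      nlinarith [mul_neg_of_pos_of_neg hlt hc]
  refine ⟨ha, ?_⟩
  subst ha
  have lim2 : Filter.Tendsto (fun t : ℝ => b + t * c + t^2 * e) (nhds 0) (nhds b) := by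
    have : Continuous (fun t : ℝ => b + t * c + t^2 * e) := by fun_prop
    simpa using this.tendsto 0
  refine ge_of_tendsto (lim2.mono_left (nhdsWithin_le_nhds (s := Set.Ioi 0))) ?_
  filter_upwards [h.filter_mono nhdsWithin_le_nhds, self_mem_nhdsWithin] with t ht hlt
  have hlt : 0 < t := hlt
  by_contra hc
  push Not at hc
  nlinarith [mul_neg_of_pos_of_neg (pow_pos hlt 2) hc]

lemma aux_expand {m d : ℕ} (C : Matrix (Fin m) (Fin m) ℝ) (hC : C.IsSymm)
    (Z H : Matrix (Fin m) (Fin d) ℝ) (t : ℝ) :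
    -((Z + t • H)ᵀ * C * (Z + t • H)).trace
      + (((Z + t • H)ᵀ * (Z + t • H)) * ((Z + t • H)ᵀ * (Z + t • H))).trace
    = (-(Zᵀ * C * Z).trace + ((Zᵀ * Z) * (Zᵀ * Z)).trace)
      + (t * (2 * (Hᵀ * ((2:ℝ) • (Z * (Zᵀ * Z)) - C * Z)).trace)
      + t^2 * (-(Hᵀ * C * H).trace + ((Zᵀ * H + Hᵀ * Z) * (Zᵀ * H + Hᵀ * Z)).trace
          + 2 * ((Zᵀ * Z) * (Hᵀ * H)).trace)
      + t^3 * (2 * ((Zᵀ * H + Hᵀ * Z) * (Hᵀ * H)).trace)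
      + t^4 * ((Hᵀ * H) * (Hᵀ * H)).trace) := by
  have e1 : (Zᵀ * C * H).trace = (Hᵀ * C * Z).trace := by
    rw [← trace_transpose]; simp [hC.eq, Matrix.mul_assoc]
  have e0 : (Z + t • H)ᵀ * (Z + t • H) = Zᵀ * Z + t • (Zᵀ * H + Hᵀ * Z) + t^2 • (Hᵀ * H) := by
    simp only [transpose_add, transpose_smul, Matrix.add_mul, Matrix.mul_add, Matrix.smul_mul,
      Matrix.mul_smul]
    module
  have e2 : ((Zᵀ * H) * (Zᵀ * Z)).trace = (Hᵀ * (Z * (Zᵀ * Z))).trace := by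
    rw [← trace_transpose]
    simp only [transpose_mul, transpose_transpose]
    rw [trace_mul_comm]; simp only [Matrix.mul_assoc]
  have e3 : (Zᵀ * Z * (Zᵀ * H + Hᵀ * Z)).trace = 2 * (Hᵀ * (Z * (Zᵀ * Z))).trace := by
    rw [trace_mul_comm, Matrix.add_mul, trace_add, e2]; simp only [Matrix.mul_assoc]; ring
  rw [e0]
  generalize Zᵀ * H + Hᵀ * Z = A at *
  simp only [transpose_add, transpose_smul, Matrix.add_mul, Matrix.mul_add, Matrix.smul_mul,
      Matrix.mul_smul, Matrix.mul_sub, trace_add, trace_sub, trace_smul, smul_eq_mul, e1, e3]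
  rw [trace_mul_comm A (Zᵀ * Z), e3, trace_mul_comm (Hᵀ * H) (Zᵀ * Z),
    trace_mul_comm (Hᵀ * H) A, Matrix.mul_assoc Hᵀ C Z]
  ring

lemma aux_tr_nonneg {n k : ℕ} (A : Matrix (Fin n) (Fin n) ℝ)
    (hA : ∀ x : Fin n → ℝ, 0 ≤ x ⬝ᵥ (A *ᵥ x)) (Z : Matrix (Fin n) (Fin k) ℝ) :
    0 ≤ (Zᵀ * A * Z).trace := by
  unfold Matrix.trace
  apply Finset.sum_nonneg
  intro i _
  have := hA (fun j => Z j i)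
  rw [Matrix.mul_assoc, diag_apply, Matrix.mul_apply]
  exact this

lemma aux_sq_nonneg {n : ℕ} (T : Matrix (Fin n) (Fin n) ℝ) (hT : Tᵀ = T) :
    0 ≤ (T * T).trace := by
  have := aux_tr_nonneg 1 (fun x => by simpa using aux_dot_nonneg x) T
  simpa [hT] using this

lemma aux_spec {d : ℕ} (G : Matrix (Fin d) (Fin d) ℝ) (hG : Gᵀ = G) :
    ∃ U : Matrix (Fin d) (Fin d) ℝ, ∃ l : Fin d → ℝ, U * Uᵀ = 1 ∧ Uᵀ * U = 1 ∧
      G = U * diagonal l * Uᵀ := by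
  have hH : G.IsHermitian := by
    rw [Matrix.IsHermitian, conjTranspose_eq_transpose_of_trivial, hG]
  have h := hH.spectral_theorem
  refine ⟨hH.eigenvectorUnitary, hH.eigenvalues, ?_, ?_, ?_⟩
  · have := Unitary.coe_mul_star_self hH.eigenvectorUnitary
    simpa [star_eq_conjTranspose] using this
  · have := Unitary.coe_star_mul_self hH.eigenvectorUnitary
    simpa [star_eq_conjTranspose] using this
  · conv_lhs => rw [h]
    simp [Unitary.conjStarAlgAut_apply, star_eq_conjTranspose, Function.comp_def]

lemma aux_minev {d : ℕ} (hd : 0 < d) (G : Matrix (Fin d) (Fin d) ℝ) (hG : Gᵀ = G) :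
    ∃ s : ℝ, ∃ v : Fin d → ℝ, v ⬝ᵥ v = 1 ∧ v ⬝ᵥ (G *ᵥ v) = s ∧
      ∀ x, s * (x ⬝ᵥ x) ≤ x ⬝ᵥ (G *ᵥ x) := by
  obtain ⟨U, l, h1, h2, h3⟩ := aux_spec G hG
  have : Nonempty (Fin d) := ⟨⟨0, hd⟩⟩
  obtain ⟨i, hi⟩ := Finite.exists_min l
  have key : ∀ x, x ⬝ᵥ (G *ᵥ x) = ∑ j, l j * (Uᵀ *ᵥ x) j ^ 2 := by
    intro x
    rw [h3, ← mulVec_mulVec, ← mulVec_mulVec, dotProduct_mulVec, ← mulVec_transpose]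
    simp only [dotProduct, mulVec_diagonal]
    exact Finset.sum_congr rfl fun j _ => by ring
  have key1 : ∀ x, x ⬝ᵥ x = ∑ j, (Uᵀ *ᵥ x) j ^ 2 := by
    intro x
    have : x ⬝ᵥ x = (Uᵀ *ᵥ x) ⬝ᵥ (Uᵀ *ᵥ x) := by
      rw [dotProduct_mulVec, vecMul_transpose, mulVec_mulVec, h1, one_mulVec]
    rw [this]
    simp only [dotProduct]
    exact Finset.sum_congr rfl fun j _ => by ring
  have hv : Uᵀ *ᵥ (U *ᵥ Pi.single i 1) = Pi.single i 1 := by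
    rw [mulVec_mulVec, h2, one_mulVec]
  refine ⟨l i, U *ᵥ Pi.single i 1, ?_, ?_, ?_⟩
  · rw [key1, hv]; simp [Pi.single_apply]
  · rw [key, hv]; simp [Pi.single_apply]
  · intro x
    rw [key, key1, Finset.mul_sum]
    exact Finset.sum_le_sum fun j _ => mul_le_mul_of_nonneg_right (hi j) (sq_nonneg _)

lemma aux_proj {m d : ℕ} (Z : Matrix (Fin m) (Fin d) ℝ) :
    ∃ Q : Matrix (Fin m) (Fin m) ℝ, Qᵀ = Q ∧ Q * Q = Q ∧ Q * Z = Z ∧ Q.trace ≤ d := by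
  obtain ⟨U, l, h1, h2, h3⟩ := aux_spec (Zᵀ * Z) (by simp)
  set Y := Z * U with hY
  have hYY : Yᵀ * Y = diagonal l := by
    have : Yᵀ * Y = Uᵀ * (Zᵀ * Z) * U := by simp [hY, Matrix.mul_assoc]
    rw [this, h3]
    calc _ = (Uᵀ * U) * diagonal l * (Uᵀ * U) := by simp only [Matrix.mul_assoc]
      _ = _ := by simp [h2]
  have hZ : Z = Y * Uᵀ := by rw [hY, Matrix.mul_assoc, h1, Matrix.mul_one]
  have hY0 : Y * (diagonal (fun i => (l i)⁻¹) * diagonal l) = Y := by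
    rw [diagonal_mul_diagonal]
    ext i j
    rw [mul_diagonal]
    by_cases hl : l j = 0
    · have : (Yᵀ * Y) j j = 0 := by rw [hYY]; simp [hl]
      rw [Matrix.mul_apply] at this
      simp only [transpose_apply] at this
      have := (Finset.sum_eq_zero_iff_of_nonneg (fun k _ => mul_self_nonneg (Y k j))).1 this i
        (Finset.mem_univ _)
      have := mul_self_eq_zero.1 this
      simp [this]
    · rw [inv_mul_cancel₀ hl, mul_one]
  have hQY : (Y * diagonal (fun i => (l i)⁻¹) * Yᵀ) * Y = Y := by
    rw [Matrix.mul_assoc, hYY, Matrix.mul_assoc, hY0]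
  refine ⟨Y * diagonal (fun i => (l i)⁻¹) * Yᵀ, ?_, ?_, ?_, ?_⟩
  · simp [Matrix.mul_assoc]
  · rw [← Matrix.mul_assoc, ← Matrix.mul_assoc, hQY]
  · conv_lhs => rw [hZ]
    rw [← Matrix.mul_assoc, hQY, ← hZ]
  · rw [Matrix.mul_assoc, trace_mul_comm, Matrix.mul_assoc, hYY, diagonal_mul_diagonal,
      trace_diagonal]
    calc _ ≤ ∑ i : Fin d, (1:ℝ) := by
          apply Finset.sum_le_sum
          intro i _
          by_cases hl : l i = 0
          · simp [hl]
          · rw [inv_mul_cancel₀ hl]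
      _ = d := by simp

/-- The value of the second-order term along `u vᵀ`. -/
lemma aux_rank1 {m d : ℕ} (C : Matrix (Fin m) (Fin m) ℝ)
    (Z : Matrix (Fin m) (Fin d) ℝ) (u : Fin m → ℝ) (v : Fin d → ℝ) :
    (-((vecMulVec u v)ᵀ * C * (vecMulVec u v)).trace
      + ((Zᵀ * (vecMulVec u v) + (vecMulVec u v)ᵀ * Z)
          * (Zᵀ * (vecMulVec u v) + (vecMulVec u v)ᵀ * Z)).trace
          + 2 * ((Zᵀ * Z) * ((vecMulVec u v)ᵀ * (vecMulVec u v))).trace)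
    = -((v ⬝ᵥ v) * (u ⬝ᵥ (C *ᵥ u))) + (2 * ((Zᵀ *ᵥ u) ⬝ᵥ v)^2
        + 2 * ((Zᵀ *ᵥ u) ⬝ᵥ (Zᵀ *ᵥ u)) * (v ⬝ᵥ v))
      + 2 * ((u ⬝ᵥ u) * (v ⬝ᵥ ((Zᵀ * Z) *ᵥ v))) := by
  have e1 : ((vecMulVec u v)ᵀ * C * (vecMulVec u v)).trace = (v ⬝ᵥ v) * (u ⬝ᵥ (C *ᵥ u)) := by
    rw [transpose_vecMulVec, Matrix.mul_assoc, mul_vecMulVec, vecMulVec_mul_vecMulVec,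
      trace_vecMulVec]
    simp [mul_comm]
  have e2 : ((Zᵀ * Z) * ((vecMulVec u v)ᵀ * (vecMulVec u v))).trace
      = (u ⬝ᵥ u) * (v ⬝ᵥ ((Zᵀ * Z) *ᵥ v)) := by
    rw [transpose_vecMulVec, vecMulVec_mul_vecMulVec, mul_vecMulVec, trace_vecMulVec]
    simp [dotProduct_comm]
  have e3 : (vecMulVec u v)ᵀ * Z = vecMulVec v (Zᵀ *ᵥ u) := by
    rw [transpose_vecMulVec, vecMulVec_mul, mulVec_transpose]
  rw [e1, e2, e3, mul_vecMulVec]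
  generalize Zᵀ *ᵥ u = w
  simp only [Matrix.add_mul, Matrix.mul_add, vecMulVec_mul_vecMulVec, trace_add, trace_vecMulVec,
    dotProduct_smul, smul_eq_mul]
  rw [dotProduct_comm v w]
  ring

theorem no_suboptimal_local_minima_quartic_canonical
    (m d : ℕ) (C : Matrix (Fin m) (Fin m) ℝ) (hC : C.IsSymm)
    (L : Matrix (Fin m) (Fin d) ℝ → ℝ)
    (hL : ∀ Z, L Z = -(Zᵀ * C * Z).trace + ((Zᵀ * Z) * (Zᵀ * Z)).trace)
    (Z₀ : Matrix (Fin m) (Fin d) ℝ) (hmin : IsLocalMin L Z₀) :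
    ∀ Z : Matrix (Fin m) (Fin d) ℝ, L Z₀ ≤ L Z := by
  intro Z
  rcases Nat.eq_zero_or_pos d with hd | hd
  · subst hd
    rw [Subsingleton.elim Z₀ Z]
  -- first and second order conditions
  have cond : ∀ H : Matrix (Fin m) (Fin d) ℝ,
      2 * (Hᵀ * ((2:ℝ) • (Z₀ * (Z₀ᵀ * Z₀)) - C * Z₀)).trace = 0 ∧
      0 ≤ -(Hᵀ * C * H).trace + ((Z₀ᵀ * H + Hᵀ * Z₀) * (Z₀ᵀ * H + Hᵀ * Z₀)).trace
          + 2 * ((Z₀ᵀ * Z₀) * (Hᵀ * H)).trace := by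
    intro H
    have hcont : Filter.Tendsto (fun t : ℝ => Z₀ + t • H) (nhds 0) (nhds Z₀) := by
      have : Continuous (fun t : ℝ => Z₀ + t • H) := by fun_prop
      simpa using this.tendsto 0
    refine aux_poly _ _ (2 * ((Z₀ᵀ * H + Hᵀ * Z₀) * (Hᵀ * H)).trace)
      ((Hᵀ * H) * (Hᵀ * H)).trace ?_
    filter_upwards [hcont.eventually hmin] with t ht
    rw [hL, hL, aux_expand C hC] at ht
    linarith
  have first : C * Z₀ = (2:ℝ) • (Z₀ * (Z₀ᵀ * Z₀)) := by
    have h := (cond ((2:ℝ) • (Z₀ * (Z₀ᵀ * Z₀)) - C * Z₀)).1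
    generalize hF : (2:ℝ) • (Z₀ * (Z₀ᵀ * Z₀)) - C * Z₀ = F at h
    have h0 : (Fᴴ * F).trace = 0 := by
      rw [conjTranspose_eq_transpose_of_trivial]; linarith
    rw [trace_conjTranspose_mul_self_eq_zero_iff] at h0
    rw [h0] at hF
    exact (sub_eq_zero.1 hF).symm
  have second := fun u v => (aux_rank1 C Z₀ u v) ▸ (cond (vecMulVec u v)).2
  obtain ⟨s, v, hv1, hvs, hs⟩ := aux_minev hd (Z₀ᵀ * Z₀) (by simp)
  have hGq : ∀ x, x ⬝ᵥ ((Z₀ᵀ * Z₀) *ᵥ x) = (Z₀ *ᵥ x) ⬝ᵥ (Z₀ *ᵥ x) := by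
    intro x
    rw [← mulVec_mulVec, dotProduct_mulVec, vecMul_transpose]
  have hs0 : 0 ≤ s := by
    rw [← hvs, hGq]; exact aux_dot_nonneg _
  -- set-up
  set M := Z₀ * Z₀ᵀ with hM
  set N := Z * Zᵀ with hN
  have hMt : Mᵀ = M := by simp [hM]
  have hNt : Nᵀ = N := by simp [hN]
  have hMq : ∀ x, x ⬝ᵥ (M *ᵥ x) = (Z₀ᵀ *ᵥ x) ⬝ᵥ (Z₀ᵀ *ᵥ x) := by
    intro x
    rw [hM, ← mulVec_mulVec, dotProduct_mulVec, ← mulVec_transpose]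
  have hCM : C * M = (2:ℝ) • (M * M) := by
    rw [hM, ← Matrix.mul_assoc, first]; simp [Matrix.mul_assoc]
  have tC : ∀ (W : Matrix (Fin m) (Fin d) ℝ) (A : Matrix (Fin m) (Fin m) ℝ),
      (Wᵀ * A * W).trace = (A * (W * Wᵀ)).trace := by
    intro W A
    rw [Matrix.mul_assoc, trace_mul_comm, Matrix.mul_assoc]
  have tQ : ∀ (W : Matrix (Fin m) (Fin d) ℝ),
      ((Wᵀ * W) * (Wᵀ * W)).trace = ((W * Wᵀ) * (W * Wᵀ)).trace := by
    intro W
    rw [Matrix.mul_assoc, trace_mul_comm]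
    simp only [Matrix.mul_assoc]
  rw [hL, hL, tC, tC, tQ, tQ, ← hM, ← hN, hCM, trace_smul, smul_eq_mul]
  suffices hgoal : (C * N).trace ≤ (N * N).trace + (M * M).trace by linarith
  rcases hs0.eq_or_lt with hs00 | hspos
  · have hZv : Z₀ *ᵥ v = 0 := by
      rw [← hs00, hGq] at hvs
      exact dotProduct_self_eq_zero.1 hvs
    have h1 : 0 ≤ (Zᵀ * ((2:ℝ) • M - C) * Z).trace := by
      apply aux_tr_nonneg
      intro u
      have h := second u v
      have hw : (Z₀ᵀ *ᵥ u) ⬝ᵥ v = 0 := by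
        rw [mulVec_transpose, ← dotProduct_mulVec, hZv, dotProduct_zero]
      rw [hv1, hvs, hw, ← hs00, ← hMq] at h
      rw [sub_mulVec, smul_mulVec, dotProduct_sub, dotProduct_smul, smul_eq_mul]
      linarith
    have h2 := aux_sq_nonneg (N - M) (by simp [hMt, hNt])
    rw [tC, ← hN] at h1
    simp only [Matrix.sub_mul, Matrix.mul_sub, trace_sub, Matrix.smul_mul, trace_smul,
      smul_eq_mul] at h1 h2
    rw [trace_mul_comm N M] at h2
    linarith
  · -- full column rank
    set G := Z₀ᵀ * Z₀ with hG
    have hGt : Gᵀ = G := by simp [hG]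
    have hdet : IsUnit G.det := by
      rw [isUnit_iff_ne_zero]
      intro h0
      obtain ⟨x, hx, hx0⟩ := exists_mulVec_eq_zero_iff.2 h0
      have := hs x
      rw [hx0, dotProduct_zero] at this
      have h3 : 0 ≤ x ⬝ᵥ x := aux_dot_nonneg x
      have h4 : x ⬝ᵥ x = 0 := by nlinarith
      exact hx (dotProduct_self_eq_zero.1 h4)
    have hGi : G * G⁻¹ = 1 := mul_nonsing_inv _ hdet
    have hGi' : G⁻¹ * G = 1 := nonsing_inv_mul _ hdet
    have hGit : (G⁻¹)ᵀ = G⁻¹ := by rw [transpose_nonsing_inv, hGt]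
    obtain ⟨P, hP⟩ : ∃ P, P = Z₀ * G⁻¹ * Z₀ᵀ := ⟨_, rfl⟩
    have hPt : Pᵀ = P := by rw [hP]; simp [hGit, Matrix.mul_assoc]
    have hPZ : P * Z₀ = Z₀ := by
      rw [hP, Matrix.mul_assoc, ← hG, Matrix.mul_assoc, hGi', Matrix.mul_one]
    have hPP : P * P = P := by
      nth_rewrite 2 [hP]
      rw [← Matrix.mul_assoc, ← Matrix.mul_assoc, hPZ, ← hP]
    have hPM : P * M = M := by rw [hM, ← Matrix.mul_assoc, hPZ]
    have hMP : M * P = M := by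
      have := congrArg transpose hPM
      rwa [transpose_mul, hPt, hMt] at this
    have hPtr : P.trace = d := by
      rw [hP, Matrix.mul_assoc, trace_mul_comm, Matrix.mul_assoc, ← hG, hGi', trace_one]
      simp
    have hZP : Z₀ᵀ * P = Z₀ᵀ := by
      have := congrArg transpose hPZ
      rwa [transpose_mul, hPt] at this
    have hCP : C * P = (2:ℝ) • M := by
      rw [hP, ← Matrix.mul_assoc, ← Matrix.mul_assoc, first]
      simp only [Matrix.smul_mul]
      rw [Matrix.mul_assoc Z₀ G, hGi, Matrix.mul_one]
    have hPC : P * C = (2:ℝ) • M := by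
      have := congrArg transpose hCP
      rwa [transpose_mul, hPt, hC.eq, transpose_smul, hMt] at this
    -- (a)
    have ha : 0 ≤ (Zᵀ * ((2 * s) • (1 - P) - C + (2:ℝ) • M) * Z).trace := by
      apply aux_tr_nonneg
      intro x
      have hu : Z₀ᵀ *ᵥ ((1 - P) *ᵥ x) = 0 := by
        rw [mulVec_mulVec, Matrix.mul_sub, hZP, Matrix.mul_one, sub_self, zero_mulVec]
      have h := second ((1 - P) *ᵥ x) v
      rw [hu, hv1, hvs] at h
      have q : ∀ A : Matrix (Fin m) (Fin m) ℝ, ((1 - P) *ᵥ x) ⬝ᵥ (A *ᵥ ((1 - P) *ᵥ x))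
          = x ⬝ᵥ (((1 - P) * A * (1 - P)) *ᵥ x) := by
        intro A
        rw [← mulVec_mulVec, ← mulVec_mulVec, dotProduct_mulVec x (1 - P), ← mulVec_transpose]
        simp [hPt]
      have q1 := q 1
      rw [one_mulVec] at q1
      rw [q1, q C] at h
      have i1 : (1 - P) * 1 * (1 - P) = 1 - P := by
        simp [Matrix.mul_sub, Matrix.sub_mul, hPP]
      have i2 : (1 - P) * C * (1 - P) = C - (2:ℝ) • M := by
        simp [Matrix.mul_sub, Matrix.sub_mul, hPC, hCP, hMP]
      rw [i1, i2] at h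
      have i3 : (2 * s) • (1 - P) - C + (2:ℝ) • M = (2 * s) • (1 - P) - (C - (2:ℝ) • M) := by
        abel
      rw [i3, sub_mulVec ((2 * s) • (1 - P)), smul_mulVec, dotProduct_sub, dotProduct_smul,
        smul_eq_mul]
      simp only [dotProduct_zero, zero_dotProduct] at h
      linarith
    obtain ⟨Q, hQt, hQQ, hQZ, hQtr⟩ := aux_proj Z
    have hQN : Q * N = N := by rw [hN, ← Matrix.mul_assoc, hQZ]
    have hNQ : N * Q = N := by
      have := congrArg transpose hQN
      rwa [transpose_mul, hQt, hNt] at this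
    -- (b)
    have hR : ∀ x, 0 ≤ x ⬝ᵥ ((M - s • P) *ᵥ x) := by
      intro x
      set y := G⁻¹ *ᵥ (Z₀ᵀ *ᵥ x) with hy
      have hGy : G *ᵥ y = Z₀ᵀ *ᵥ x := by rw [hy, mulVec_mulVec, hGi, one_mulVec]
      have hPx : x ⬝ᵥ (P *ᵥ x) = y ⬝ᵥ (G *ᵥ y) := by
        rw [hGy, hP, ← mulVec_mulVec, ← mulVec_mulVec, ← hy, dotProduct_mulVec,
          ← mulVec_transpose, dotProduct_comm]
      rw [sub_mulVec, smul_mulVec, dotProduct_sub, dotProduct_smul, smul_eq_mul, hPx, hMq, ← hGy]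
      have h1 : 0 ≤ (G *ᵥ y - s • y) ⬝ᵥ (G *ᵥ y - s • y) := aux_dot_nonneg _
      have h2 := hs y
      simp only [sub_dotProduct, dotProduct_sub, smul_dotProduct, dotProduct_smul,
        smul_eq_mul] at h1
      rw [dotProduct_comm (G *ᵥ y) y] at h1
      nlinarith [mul_nonneg hs0 (sub_nonneg.2 h2)]
    have hb := aux_tr_nonneg _ hR (1 - Q)
    rw [Matrix.mul_assoc, trace_mul_comm, Matrix.mul_assoc] at hb
    have i4 : (1 - Q) * (1 - Q)ᵀ = 1 - Q := by
      simp [Matrix.mul_sub, Matrix.sub_mul, hQQ, hQt]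
    rw [i4] at hb
    have hT := aux_sq_nonneg (N - M + s • P - s • Q) (by simp [hMt, hNt, hPt, hQt])
    rw [tC, ← hN] at ha
    simp only [Matrix.sub_mul, Matrix.mul_sub, Matrix.add_mul, Matrix.mul_add, trace_sub,
      trace_add, Matrix.smul_mul, Matrix.mul_smul, trace_smul, smul_eq_mul, Matrix.mul_one,
      Matrix.one_mul, hQN, hNQ, hPM, hMP, hPP, hQQ, hPtr] at ha hb hT
    rw [trace_mul_comm N M, trace_mul_comm N P, trace_mul_comm Q M, trace_mul_comm Q P] at hT
    nlinarith [mul_nonneg hs0 hb, mul_nonneg (mul_nonneg hs0 hs0) (sub_nonneg.2 hQtr)]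
end

section
/- Let C be a symmetric m×m real matrix, let Z ∈ ℝ^{m×d} satisfy C Z = 2 Z Zᵀ Z, and let w ∈ ℝ^m be an eigenvector of Z Zᵀ with eigenvalue μ ≠ 0 (i.e., Z Zᵀ w = μ w). Then w is an eigenvector of C with eigenvalue 2μ, i.e., C w = 2 μ w. In particular, at any critical point the nonzero squared singular values s² of Z satisfy 2 s² = λ for some eigenvalue λ of C, matching the claim that at a critical point the singular values of Z equal (λ_i/2)^{1/2} for the selected eigenvalues λ_i of C. -/
open Matrix

/-- If `C` is symmetric, `Z` satisfies the critical point equation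
`C Z = 2 Z Zᵀ Z`, and `w ≠ 0` is an eigenvector of `Z Zᵀ` with eigenvalue
`μ ≠ 0`, then `w` is an eigenvector of `C` with eigenvalue `2μ`.  In
particular, every nonzero squared singular value `s² = μ` of `Z` satisfies
`2 s² = λ` for some eigenvalue `λ` of `C`. -/
theorem critical_point_eigenvector
    (m d : ℕ) (C : Matrix (Fin m) (Fin m) ℝ) (hC : C.IsSymm)
    (Z : Matrix (Fin m) (Fin d) ℝ)
    (hcrit : C * Z = (2 : ℝ) • (Z * Zᵀ * Z))
    (w : Fin m → ℝ) (hw : w ≠ 0) (μ : ℝ) (hμ : μ ≠ 0)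
    (heig : (Z * Zᵀ).mulVec w = μ • w) :
    C.mulVec w = (2 * μ) • w ∧
      ∃ lam : ℝ, 2 * μ = lam ∧ ∃ v : Fin m → ℝ, v ≠ 0 ∧ C.mulVec v = lam • v := by
  have key : C.mulVec w = (2 * μ) • w := by
    have h1 : C * (Z * Zᵀ) = (2 : ℝ) • ((Z * Zᵀ) * (Z * Zᵀ)) := by
      rw [← Matrix.mul_assoc, hcrit, Matrix.smul_mul, Matrix.mul_assoc (Z * Zᵀ)]
    have h2 : (C * (Z * Zᵀ)).mulVec w = μ • C.mulVec w := by
      rw [← Matrix.mulVec_mulVec, heig, Matrix.mulVec_smul]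
    have h3 : (C * (Z * Zᵀ)).mulVec w = μ • ((2 * μ) • w) := by
      rw [h1, Matrix.smul_mulVec, ← Matrix.mulVec_mulVec, heig, Matrix.mulVec_smul, heig]
      simp only [smul_smul]
      congr 1
      ring
    exact smul_right_injective _ hμ (h2.symm.trans h3)
  exact ⟨key, 2 * μ, rfl, w, hw, key⟩
end

section
/- Let C be a symmetric m×m real matrix with eigenvalues λ₁ ≥ λ₂ ≥ … ≥ λ_m, and let d ≤ m. Then the infimum over Z ∈ ℝ^{m×d} of L(Z) = -Tr(Zᵀ C Z) + Tr((Zᵀ Z)²) equals -(1/4) Σ_{i=1}^d max(λ_i, 0)², and this infimum is attained (for example by taking the columns of Z to be the top-d unit eigenvectors of C scaled by (max(λ_i,0)/2)^{1/2}, i.e., by selecting the top d eigenvalues of C). -/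
open Matrix

lemma sum_castLE_aux (m d : ℕ) (hdm : d ≤ m) (f : Fin m → ℝ) :
    ∑ i : Fin m, (if i.val < d then f i else 0) = ∑ j : Fin d, f (Fin.castLE hdm j) := by
  obtain ⟨k, rfl⟩ := Nat.exists_eq_add_of_le hdm
  rw [Fin.sum_univ_add]
  simp
  rfl

lemma weights_aux (m d : ℕ) (hdm : d ≤ m) (a q : Fin m → ℝ) (ha0 : ∀ i, 0 ≤ a i)
    (ha : ∀ i j : Fin m, i ≤ j → a j ≤ a i) (hq0 : ∀ i, 0 ≤ q i) (hq1 : ∀ i, q i ≤ 1)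
    (hqs : ∑ i, q i ≤ d) : ∑ i, a i * q i ≤ ∑ j : Fin d, a (Fin.castLE hdm j) := by
  obtain ⟨t, ht0, ht1, ht2⟩ : ∃ t : ℝ, 0 ≤ t ∧ (∀ i : Fin m, i.val < d → t ≤ a i) ∧
      (∀ i : Fin m, ¬ i.val < d → a i ≤ t) := by
    by_cases h : d < m
    · refine ⟨a ⟨d, h⟩, ha0 _, fun i hi => ha _ _ ?_, fun i hi => ha _ _ ?_⟩
      · rw [Fin.le_def]; simp; omega
      · rw [Fin.le_def]; simp; omega
    · exact ⟨0, le_rfl, fun i _ => ha0 i, fun i hi => absurd i.2 (by omega)⟩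
  have h1 : ∑ i, (a i - t) * q i ≤ ∑ i : Fin m, (if i.val < d then a i - t else 0) := by
    apply Finset.sum_le_sum
    intro i _
    split_ifs with h
    · nlinarith [ht1 i h, hq1 i]
    · nlinarith [ht2 i h, hq0 i]
  rw [sum_castLE_aux m d hdm (fun i => a i - t)] at h1
  simp only [sub_mul, Finset.sum_sub_distrib, ← Finset.mul_sum] at h1
  simp at h1
  nlinarith

lemma core_aux (m d : ℕ) (hdm : d ≤ m) (lam : Fin m → ℝ)
    (hsorted : ∀ i j : Fin m, i ≤ j → lam j ≤ lam i)
    (V : Matrix (Fin m) (Fin d) ℝ) (s : Fin d → ℝ) (hV : Vᵀ * V = diagonal s) :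
    -(1 / 4 : ℝ) * ∑ i : Fin d, max (lam (Fin.castLE hdm i)) 0 ^ 2 ≤
      -(∑ j, ∑ i, lam i * V i j ^ 2) + ∑ j, s j ^ 2 := by
  have hs : ∀ j, ∑ i, V i j ^ 2 = s j := by
    intro j
    have := congrFun (congrFun hV j) j
    simp [Matrix.mul_apply] at this
    rw [← this]
    exact Finset.sum_congr rfl fun i _ => by ring
  have hs0 : ∀ j, 0 ≤ s j := fun j => hs j ▸ Finset.sum_nonneg fun i _ => sq_nonneg _
  set c : Fin d → ℝ := fun j => (√(s j))⁻¹ with hc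
  have hc2 : ∀ j, s j ≠ 0 → c j ^ 2 * s j = 1 := by
    intro j hj
    simp only [hc, inv_pow, Real.sq_sqrt (hs0 j)]
    exact inv_mul_cancel₀ hj
  have hc0 : ∀ j, s j = 0 → c j = 0 := by
    intro j hj; simp [hc, hj]
  set N : Matrix (Fin m) (Fin d) ℝ := V * diagonal c with hN
  have hNN : Nᵀ * N = diagonal (fun j => c j ^ 2 * s j) := by
    rw [hN, transpose_mul, diagonal_transpose, Matrix.mul_assoc, ← Matrix.mul_assoc Vᵀ, hV,
      diagonal_mul_diagonal, diagonal_mul_diagonal]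
    congr 1; ext j; ring
  have hNe : N * diagonal (fun j => c j ^ 2 * s j) = N := by
    rw [hN, Matrix.mul_assoc, diagonal_mul_diagonal]
    congr 2; ext j
    by_cases h : s j = 0
    · simp [hc0 j h]
    · simp [hc2 j h]
  have hP : (N * Nᵀ) * (N * Nᵀ) = N * Nᵀ := by
    rw [Matrix.mul_assoc, ← Matrix.mul_assoc Nᵀ, hNN, ← Matrix.mul_assoc, hNe]
  set q : Fin m → ℝ := fun i => ∑ j, N i j ^ 2 with hq
  have hqP : ∀ i, (N * Nᵀ) i i = q i := by
    intro i; simp only [Matrix.mul_apply, transpose_apply, hq]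
    exact Finset.sum_congr rfl fun i _ => by ring
  have hq0 : ∀ i, 0 ≤ q i := fun i => Finset.sum_nonneg fun j _ => sq_nonneg _
  have hq1 : ∀ i, q i ≤ 1 := by
    intro i
    have h1 : ∑ k, (N * Nᵀ) i k ^ 2 = q i := by
      rw [← hqP i]
      conv_rhs => rw [← hP, Matrix.mul_apply]
      refine Finset.sum_congr rfl fun k _ => ?_
      have : (N * Nᵀ) k i = (N * Nᵀ) i k := by
        simp only [Matrix.mul_apply, transpose_apply, mul_comm]
      rw [this]; ring
    have h2 : q i ^ 2 ≤ q i := by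
      conv_rhs => rw [← h1]
      rw [← hqP i]
      exact Finset.single_le_sum (f := fun k => (N * Nᵀ) i k ^ 2)
        (fun k _ => sq_nonneg _) (Finset.mem_univ i)
    nlinarith
  have hcol : ∀ j, ∑ i, N i j ^ 2 = c j ^ 2 * s j := by
    intro j
    rw [← hs j, Finset.mul_sum]
    refine Finset.sum_congr rfl fun i _ => ?_
    simp [hN, Matrix.mul_diagonal]; ring
  have hqs : ∑ i, q i ≤ d := by
    simp only [hq]
    rw [Finset.sum_comm]
    calc _ ≤ ∑ j : Fin d, (1:ℝ) := by
          refine Finset.sum_le_sum fun j _ => ?_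
          rw [hcol]
          by_cases h : s j = 0
          · simp [h]
          · exact (hc2 j h).le
      _ = d := by simp
  have hw := weights_aux m d hdm (fun i => max (lam i) 0 ^ 2) q (fun i => sq_nonneg _)
    (fun i j hij => by
      have := hsorted i j hij
      gcongr) hq0 hq1 hqs
  have hj : ∀ j, -(1/4:ℝ) * ∑ i, max (lam i) 0 ^ 2 * N i j ^ 2 ≤
      -(∑ i, lam i * V i j ^ 2) + s j ^ 2 := by
    intro j
    have hVN : ∀ i, V i j ^ 2 = s j * N i j ^ 2 := by
      intro i
      by_cases h : s j = 0
      · have h0 := hs j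
        rw [h, Finset.sum_eq_zero_iff_of_nonneg (fun i _ => sq_nonneg _)] at h0
        rw [h0 i (Finset.mem_univ i), h]; ring
      · have := hc2 j h
        simp only [hN, Matrix.mul_diagonal]
        linear_combination (-(V i j)^2) * this
    have h2 : s j ^ 2 = ∑ i, s j ^ 2 * N i j ^ 2 := by
      rw [← Finset.mul_sum, hcol]
      by_cases h : s j = 0
      · simp [h]
      · rw [hc2 j h]; ring
    rw [h2, ← Finset.sum_neg_distrib, ← Finset.sum_add_distrib, Finset.mul_sum]
    refine Finset.sum_le_sum fun i _ => ?_
    rw [hVN i]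
    have hx : 0 ≤ N i j ^ 2 := sq_nonneg _
    have hy : 0 ≤ s j ^ 2 - s j * lam i + (1/4) * max (lam i) 0 ^ 2 := by
      have h3 : s j * lam i ≤ s j * max (lam i) 0 :=
        mul_le_mul_of_nonneg_left (le_max_left _ _) (hs0 j)
      nlinarith [sq_nonneg (s j - max (lam i) 0 / 2)]
    nlinarith [mul_nonneg hx hy]
  have hsum := Finset.sum_le_sum fun j (_ : j ∈ Finset.univ) => hj j
  rw [← Finset.mul_sum, Finset.sum_comm, Finset.sum_add_distrib, Finset.sum_neg_distrib] at hsum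
  simp only [← Finset.mul_sum] at hsum
  change -(1/4:ℝ) * ∑ i, max (lam i) 0 ^ 2 * q i ≤ _ at hsum
  linarith

lemma trace_aux {m d : ℕ} (lam : Fin m → ℝ) (W : Matrix (Fin m) (Fin d) ℝ) :
    (Wᵀ * diagonal lam * W).trace = ∑ j, ∑ i, lam i * W i j ^ 2 := by
  simp only [Matrix.trace, Matrix.diag, Matrix.mul_apply (M := Wᵀ * diagonal lam),
    Matrix.mul_diagonal, transpose_apply]
  exact Finset.sum_congr rfl fun j _ => Finset.sum_congr rfl fun i _ => by ring

lemma spectral_aux {d : ℕ} (G : Matrix (Fin d) (Fin d) ℝ) (hG : G.IsHermitian) :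
    ∃ (Q : Matrix (Fin d) (Fin d) ℝ) (s : Fin d → ℝ), Q * Qᵀ = 1 ∧ Qᵀ * G * Q = diagonal s := by
  refine ⟨hG.eigenvectorUnitary, hG.eigenvalues, ?_, ?_⟩
  · have := Unitary.coe_mul_star_self hG.eigenvectorUnitary
    simpa [star_eq_conjTranspose] using this
  · have := hG.conjStarAlgAut_star_eigenvectorUnitary
    simpa [Unitary.conjStarAlgAut_apply, star_eq_conjTranspose] using this

/-- If `C` is symmetric with eigenvalues `lam 0 ≥ lam 1 ≥ …`
(listed in descending order with multiplicity, via an orthogonal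
diagonalization `C = U diag(lam) Uᵀ`), and `d ≤ m`, then the infimum over
`Z ∈ ℝ^{m×d}` of `L(Z) = -Tr(Zᵀ C Z) + Tr((Zᵀ Z)²)` equals
`-(1/4) ∑_{i<d} max(lam i, 0)²`, and it is attained. -/
theorem quartic_loss_infimum
    (m d : ℕ) (hdm : d ≤ m)
    (C : Matrix (Fin m) (Fin m) ℝ) (hC : C.IsSymm)
    (lam : Fin m → ℝ) (U : Matrix (Fin m) (Fin m) ℝ)
    (hU : Uᵀ * U = 1) (hdiag : C = U * Matrix.diagonal lam * Uᵀ)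
    (hsorted : ∀ i j : Fin m, i ≤ j → lam j ≤ lam i) :
    IsLeast
      (Set.range fun Z : Matrix (Fin m) (Fin d) ℝ =>
        -(Zᵀ * C * Z).trace + ((Zᵀ * Z) * (Zᵀ * Z)).trace)
      (-(1 / 4 : ℝ) * ∑ i : Fin d, max (lam (Fin.castLE hdm i)) 0 ^ 2) := by
  have hU' : U * Uᵀ = 1 := mul_eq_one_comm.mp hU
  constructor
  · set μ : Fin d → ℝ := fun j => max (lam (Fin.castLE hdm j)) 0 with hμ
    set W : Matrix (Fin m) (Fin d) ℝ :=
      Matrix.of fun i j => if i = Fin.castLE hdm j then √(μ j / 2) else 0 with hW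
    have hμ0 : ∀ j, 0 ≤ μ j := fun j => le_max_right _ _
    have hWW : Wᵀ * W = diagonal (fun j => μ j / 2) := by
      ext j k
      simp only [Matrix.mul_apply, transpose_apply, hW, Matrix.of_apply, Matrix.diagonal_apply]
      by_cases h : j = k
      · subst h
        simp [-Real.sqrt_div', Real.mul_self_sqrt (div_nonneg (hμ0 j) zero_le_two)]
      · simp [h, Ne.symm h, Fin.castLE_inj]
    refine ⟨U * W, ?_⟩
    have e1 : (U * W)ᵀ * C * (U * W) = Wᵀ * diagonal lam * W := by
      calc _ = Wᵀ * (Uᵀ * U) * diagonal lam * (Uᵀ * U) * W := by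
            rw [hdiag, transpose_mul]; simp only [Matrix.mul_assoc]
        _ = _ := by rw [hU]; simp
    have e2 : (U * W)ᵀ * (U * W) = Wᵀ * W := by
      calc _ = Wᵀ * (Uᵀ * U) * W := by
            rw [transpose_mul]; simp only [Matrix.mul_assoc]
        _ = _ := by rw [hU]; simp
    dsimp only
    rw [e1, e2, trace_aux, hWW, diagonal_mul_diagonal, trace_diagonal, Finset.mul_sum,
      ← Finset.sum_neg_distrib, ← Finset.sum_add_distrib]
    refine Finset.sum_congr rfl fun j _ => ?_
    have e3 : ∑ i, lam i * W i j ^ 2 = lam (Fin.castLE hdm j) * (μ j / 2) := by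
      simp [-Real.sqrt_div', hW, ite_pow, Real.sq_sqrt (div_nonneg (hμ0 j) zero_le_two)]
    have e4 : lam (Fin.castLE hdm j) * μ j = μ j ^ 2 := by
      simp only [hμ]
      rcases le_total (lam (Fin.castLE hdm j)) 0 with h | h
      · simp [max_eq_right h]
      · rw [max_eq_left h]; ring
    rw [e3]
    linear_combination (-1/2) * e4
  · rintro _ ⟨Z, rfl⟩
    obtain ⟨Q, s, hQ, hG⟩ := spectral_aux (Zᵀ * Z) (by
      rw [Matrix.IsHermitian, conjTranspose_eq_transpose_of_trivial, transpose_mul,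
        transpose_transpose])
    have hQ' : Qᵀ * Q = 1 := mul_eq_one_comm.mp hQ
    have hV : (Uᵀ * Z * Q)ᵀ * (Uᵀ * Z * Q) = diagonal s := by
      rw [← hG]
      calc _ = Qᵀ * (Zᵀ * (U * Uᵀ) * Z) * Q := by
            simp only [transpose_mul, transpose_transpose, Matrix.mul_assoc]
        _ = _ := by rw [hU']; simp
    refine (core_aux m d hdm lam hsorted (Uᵀ * Z * Q) s hV).trans (le_of_eq ?_)
    dsimp only
    rw [← trace_aux]
    refine congrArg₂ (fun x y : ℝ => -x + y) ?_ ?_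
    · calc _ = (Qᵀ * (Zᵀ * C * Z * Q)).trace := by
            rw [hdiag]; simp only [transpose_mul, transpose_transpose, Matrix.mul_assoc]
        _ = (Zᵀ * C * Z * (Q * Qᵀ)).trace := by
            rw [Matrix.trace_mul_comm]; simp only [Matrix.mul_assoc]
        _ = _ := by rw [hQ]; simp
    · calc _ = (diagonal s * diagonal s).trace := by
            rw [diagonal_mul_diagonal, trace_diagonal]
            exact Finset.sum_congr rfl fun j _ => by ring
        _ = (Qᵀ * ((Zᵀ * Z) * (Q * Qᵀ) * (Zᵀ * Z) * Q)).trace := by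
            rw [← hG]; simp only [Matrix.mul_assoc]
        _ = ((Zᵀ * Z) * (Q * Qᵀ) * (Zᵀ * Z) * (Q * Qᵀ)).trace := by
            rw [Matrix.trace_mul_comm]; simp only [Matrix.mul_assoc]
        _ = _ := by rw [hQ]; simp
end

section
/- Fix λ ∈ ℝ with λ ≠ 0 and s₀ ∈ ℝ with s₀ ≠ 0 such that λ s₀² < 1. Define s(t) = s₀ / (λ s₀² + (1 - λ s₀²) e^{-8λt})^{1/2} for t ≥ 0 (the denominator is strictly positive for all t ≥ 0 under these hypotheses when λ < 0, and when λ > 0 provided 0 < λ s₀² < 1 — in the case λ > 0 additionally assume λ s₀² > 0, which holds automatically). Then s(0) = s₀ and s satisfies the gradient flow ODE ds/dt = -4 λ s (λ s² - 1) for all t ≥ 0, which is gradient descent ds/dt = -(d/ds)(λ s² - 1)² on the potential (λ s² - 1)². -/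
/-- For `λ ≠ 0`, `s₀ ≠ 0` with `λ s₀² < 1`, the function
`s(t) = s₀ / (λ s₀² + (1 - λ s₀²) e^{-8λt})^{1/2}` satisfies `s(0) = s₀` and
the gradient flow ODE `ds/dt = -4 λ s (λ s² - 1)` for all `t ≥ 0`; this ODE is
gradient descent on the potential `(λ s² - 1)²`, i.e.
`-4 λ x (λ x² - 1) = -(d/dx)(λ x² - 1)²`. -/
theorem singular_value_exact_solution
    (l s₀ : ℝ) (hl : l ≠ 0) (hs₀ : s₀ ≠ 0) (hinit : l * s₀ ^ 2 < 1)
    (s : ℝ → ℝ)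
    (hs : ∀ t : ℝ, s t =
      s₀ / Real.sqrt (l * s₀ ^ 2 + (1 - l * s₀ ^ 2) * Real.exp (-8 * l * t))) :
    s 0 = s₀ ∧
    (∀ t : ℝ, 0 ≤ t →
      HasDerivAt s (-4 * l * s t * (l * s t ^ 2 - 1)) t) ∧
    (∀ x : ℝ,
      HasDerivAt (fun u : ℝ => (l * u ^ 2 - 1) ^ 2)
        (-(-4 * l * x * (l * x ^ 2 - 1))) x) := by
  have hfun : s = fun t => s₀ / Real.sqrt (l * s₀ ^ 2 + (1 - l * s₀ ^ 2) * Real.exp (-8 * l * t)) :=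
    funext hs
  refine ⟨by simp [hs], ?_, ?_⟩
  · intro t ht
    have hD : 0 < l * s₀ ^ 2 + (1 - l * s₀ ^ 2) * Real.exp (-8 * l * t) := by
      have h1 : 0 < 1 - l * s₀ ^ 2 := by linarith
      rcases lt_or_gt_of_ne hl with h | h
      · have hE : 1 ≤ Real.exp (-8 * l * t) := by
          apply Real.one_le_exp
          have : 0 ≤ (-l) * t := mul_nonneg (by linarith) ht
          linarith
        nlinarith [mul_nonneg h1.le (sub_nonneg.2 hE)]
      · positivity
    have hlin : HasDerivAt (fun u : ℝ => -8 * l * u) (-8 * l) t := by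
      simpa using (hasDerivAt_id t).const_mul (-8 * l)
    have hd := ((hlin.exp.const_mul (1 - l * s₀ ^ 2)).const_add (l * s₀ ^ 2))
    have hq := (hasDerivAt_const t s₀).div (hd.sqrt hD.ne') (Real.sqrt_pos.2 hD).ne'
    rw [hs t, hfun]
    refine hq.congr_deriv ?_
    generalize Real.exp (-8 * l * t) = E at *
    have hr := Real.sqrt_pos.2 hD
    have hr2 := Real.sq_sqrt hD.le
    generalize Real.sqrt (l * s₀ ^ 2 + (1 - l * s₀ ^ 2) * E) = r at *
    field_simp
    rw [hr2]
    ring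
  · intro x
    have h := ((((hasDerivAt_id x).pow 2).const_mul l).sub_const 1).pow 2
    refine h.congr_deriv ?_
    simp
    ring
end

section
/- Fix λ < 0 and let s : [0,∞) → ℝ be differentiable with s(0) = s₀ and ds/dt = -4 λ s (λ s² - 1). Then |s(t)| ≤ |s₀| e^{-4|λ| t} for all t ≥ 0; in particular s(t) → 0 as t → ∞ (dimensions with negative eigenvalue collapse). -/
open Filter

/-- If `λ < 0` and `s` is differentiable with `s(0) = s₀` and
`ds/dt = -4 λ s (λ s² - 1)` on `[0,∞)`, then `|s(t)| ≤ |s₀| e^{-4|λ|t}` for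
all `t ≥ 0`; in particular `s(t) → 0` as `t → ∞`. -/
theorem negative_eigenvalue_collapse
    (l s₀ : ℝ) (hl : l < 0) (s : ℝ → ℝ) (hs0 : s 0 = s₀)
    (hs : ∀ t : ℝ, 0 ≤ t →
      HasDerivAt s (-4 * l * s t * (l * s t ^ 2 - 1)) t) :
    (∀ t : ℝ, 0 ≤ t → |s t| ≤ |s₀| * Real.exp (-4 * |l| * t)) ∧
    Tendsto s atTop (nhds 0) := by
  have hd : ∀ t : ℝ, 0 ≤ t → HasDerivAt (fun x => (s x * Real.exp (-4 * l * x)) ^ 2)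
      (-8 * (l * s t ^ 2 * Real.exp (-4 * l * t)) ^ 2) t := by
    intro t ht
    have h1 : HasDerivAt (fun x : ℝ => Real.exp (-4 * l * x))
        (Real.exp (-4 * l * t) * (-4 * l * 1)) t :=
      ((hasDerivAt_id t).const_mul (-4 * l)).exp
    have h2 := ((hs t ht).mul h1).pow 2
    refine h2.congr_deriv ?_
    simp only [Pi.mul_apply]
    push_cast
    ring
  have hanti : AntitoneOn (fun x => (s x * Real.exp (-4 * l * x)) ^ 2) (Set.Ici 0) := by
    apply antitoneOn_of_deriv_nonpos (convex_Ici 0)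
    · intro t ht
      exact (hd t ht).continuousAt.continuousWithinAt
    · intro t ht
      exact (hd t (interior_subset ht)).differentiableAt.differentiableWithinAt
    · intro t ht
      rw [(hd t (interior_subset ht)).deriv]
      nlinarith [sq_nonneg (l * s t ^ 2 * Real.exp (-4 * l * t))]
  have hb : ∀ t : ℝ, 0 ≤ t → |s t| ≤ |s₀| * Real.exp (-4 * |l| * t) := by
    intro t ht
    have h := hanti (Set.mem_Ici.2 le_rfl) (Set.mem_Ici.2 ht) ht
    simp only [mul_zero, Real.exp_zero, mul_one, hs0] at h
    have h' := sq_le_sq.1 h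
    rw [abs_mul, Real.abs_exp] at h'
    rw [abs_of_neg hl]
    have he : Real.exp (-4 * l * t) * Real.exp (-4 * -l * t) = 1 := by
      rw [← Real.exp_add, ← Real.exp_zero]
      congr 1
      ring
    calc |s t| = |s t| * Real.exp (-4 * l * t) * Real.exp (-4 * -l * t) := by
          rw [mul_assoc, he, mul_one]
      _ ≤ _ := mul_le_mul_of_nonneg_right h' (Real.exp_pos _).le
  refine ⟨hb, ?_⟩
  have hlim : Tendsto (fun t : ℝ => |s₀| * Real.exp (-4 * |l| * t)) atTop (nhds 0) := by
    have hneg : -4 * |l| < 0 := by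
      have := abs_pos.2 hl.ne
      linarith
    have h := (Real.tendsto_exp_atBot.comp
      (tendsto_id.const_mul_atTop_of_neg hneg)).const_mul |s₀|
    rw [mul_zero] at h
    exact h
  apply squeeze_zero_norm' _ hlim
  filter_upwards [eventually_ge_atTop 0] with t ht
  exact hb t ht
end

section
/- Let X, X' ∈ ℝ^{n×m}, let M ∈ ℝ^{2n×m} be X stacked on top of X', define Γ = (1/2)(Xᵀ X' + X'ᵀ X) and K̃ = M Mᵀ, and assume K̃ is invertible. Suppose e ∈ ℝ^m lies in the row space of M and satisfies Γ e = λ e for some λ ∈ ℝ. Then the vector u = M e ∈ ℝ^{2n} satisfies (M Γ Mᵀ) K̃^{-1} u = λ u; equivalently, u is a right eigenvector with eigenvalue λ of the (generally non-symmetric) matrix Q = (M Γ Mᵀ) K̃^{-1}. -/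
open Matrix

/-- With `M` the stack of `X` on `X'`,
`Γ = (1/2)(Xᵀ X' + X'ᵀ X)`, `K̃ = M Mᵀ` invertible, and `e` in the row space
of `M` with `Γ e = λ e`, the vector `u = M e` satisfies
`(M Γ Mᵀ) K̃⁻¹ u = λ u`, i.e. `u` is a right eigenvector with eigenvalue `λ`
of `Q = (M Γ Mᵀ) K̃⁻¹`. -/
theorem kernelized_eigenproblem
    (n m : ℕ) (X X' : Matrix (Fin n) (Fin m) ℝ)
    (M : Matrix (Fin n ⊕ Fin n) (Fin m) ℝ) (hM : M = Matrix.fromRows X X')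
    (Γ : Matrix (Fin m) (Fin m) ℝ)
    (hΓ : Γ = (1 / 2 : ℝ) • (Xᵀ * X' + X'ᵀ * X))
    (K : Matrix (Fin n ⊕ Fin n) (Fin n ⊕ Fin n) ℝ) (hK : K = M * Mᵀ)
    (hKinv : IsUnit K)
    (e : Fin m → ℝ) (hrow : ∃ c : (Fin n ⊕ Fin n) → ℝ, e = Mᵀ.mulVec c)
    (lam : ℝ) (heig : Γ.mulVec e = lam • e)
    (u : (Fin n ⊕ Fin n) → ℝ) (hu : u = M.mulVec e) :
    ((M * Γ * Mᵀ) * K⁻¹).mulVec u = lam • u := by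
  obtain ⟨c, hc⟩ := hrow
  have hdet : IsUnit K.det := (Matrix.isUnit_iff_isUnit_det K).mp hKinv
  have hKu : K⁻¹ *ᵥ u = c := by
    have h1 : u = K *ᵥ c := by rw [hu, hc, hK, Matrix.mulVec_mulVec]
    rw [h1, Matrix.mulVec_mulVec, Matrix.nonsing_inv_mul K hdet, Matrix.one_mulVec]
  rw [← Matrix.mulVec_mulVec, hKu, ← Matrix.mulVec_mulVec, ← hc, ← Matrix.mulVec_mulVec,
    heig, Matrix.mulVec_smul, ← hu]
end
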